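/- Let X and Y be independent real-valued random variables, each having a probability density with respect to Lebesgue measure and finite differential entropy, and suppose X + Y also has finite differential entropy. Then the entropy powers add sub-linearly: e^{2H(X+Y)} ≥ e^{2H(X)} + e^{2H(Y)}. -/

import Mathlib

open MeasureTheory ProbabilityTheory

/-- Differential entropy (in nats) of a real-valued random variable `X`,
defined via its probability density function with respect to Lebesgue measure:
`H(X) = -∫ f(x) ln f(x) dx`. -/
noncomputable def diffEntropy {Ω : Type*} [MeasureSpace Ω] (X : Ω → ℝ) : ℝ :=
  -∫ x, (MeasureTheory.pdf X ℙ volume x).toReal *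
      Real.log ((MeasureTheory.pdf X ℙ volume x).toReal)

section

open Set Filter Topology

theorem continuous_cdf (μ : Measure ℝ) [IsProbabilityMeasure μ] (hμ : μ ≪ volume) :
    Continuous (cdf μ) := by
  refine continuous_iff_continuousAt.2 fun x => ?_
  rw [(monotone_cdf μ).continuousAt_iff_leftLim_eq_rightLim, StieltjesFunction.rightLim_eq]
  have h : (cdf μ).measure {x} = 0 := by
    rw [measure_cdf]
    exact hμ Real.volume_singleton
  rw [StieltjesFunction.measure_singleton, ENNReal.ofReal_eq_zero] at h
  exact le_antisymm ((monotone_cdf μ).leftLim_le le_rfl) (by linarith)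

/-- The quantile function of a measure on the real line. -/
noncomputable def quantile (μ : Measure ℝ) (u : ℝ) : ℝ := sInf {t | u ≤ cdf μ t}

section quantile

variable {μ : Measure ℝ} {u : ℝ}

theorem nonempty_le_cdf (μ : Measure ℝ) (hu : u < 1) : {t | u ≤ cdf μ t}.Nonempty := by
  obtain ⟨t, ht⟩ := ((tendsto_cdf_atTop μ).eventually (lt_mem_nhds hu)).exists
  exact ⟨t, le_of_lt ht⟩

theorem bddBelow_le_cdf (μ : Measure ℝ) (hu : 0 < u) : BddBelow {t | u ≤ cdf μ t} := by
  obtain ⟨t, ht⟩ := ((tendsto_cdf_atBot μ).eventually (gt_mem_nhds hu)).exists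
  refine ⟨t, fun s hs => le_of_not_gt fun hst => ?_⟩
  exact absurd (hs.trans (monotone_cdf μ hst.le)) (not_le.2 ht)

theorem cdf_quantile (h : Continuous (cdf μ)) (hu : u ∈ Ioo 0 1) :
    cdf μ (quantile μ u) = u := by
  refine le_antisymm ?_ ?_
  · refine ContinuousWithinAt.closure_le (s := Iio (quantile μ u)) (f := cdf μ) (g := fun _ => u)
      (by simp) h.continuousWithinAt continuousWithinAt_const fun t ht => ?_
    exact le_of_not_ge fun hut => absurd (csInf_le (bddBelow_le_cdf μ hu.1) hut) (not_le.2 ht)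
  · exact (isClosed_le continuous_const h).csInf_mem (nonempty_le_cdf μ hu.2)
      (bddBelow_le_cdf μ hu.1)

theorem quantile_le_iff (h : Continuous (cdf μ)) (hu : u ∈ Ioo 0 1) (t : ℝ) :
    quantile μ u ≤ t ↔ u ≤ cdf μ t := by
  refine ⟨fun ht => ?_, fun ht => csInf_le (bddBelow_le_cdf μ hu.1) ht⟩
  rw [← cdf_quantile h hu]
  exact monotone_cdf μ ht

end quantile

theorem cdf_mem_Ioo {γ : Measure ℝ} [IsProbabilityMeasure γ] (hγ : volume ≪ γ) (x : ℝ) :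
    cdf γ x ∈ Ioo 0 1 := by
  have key : ∀ s : Set ℝ, volume s ≠ 0 → 0 < γ.real s := fun s hs =>
    ENNReal.toReal_pos (fun h => hs (hγ h)) (measure_ne_top _ _)
  rw [cdf_eq_real]
  refine ⟨key _ (by simp), ?_⟩
  have h1 := key (Iic x)ᶜ (by simp)
  rw [probReal_compl_eq_one_sub measurableSet_Iic] at h1
  linarith

theorem measureReal_cdf_le {γ : Measure ℝ} [IsProbabilityMeasure γ] (hγ : γ ≪ volume)
    (hγ' : volume ≪ γ) {u : ℝ} (hu : u ∈ Icc 0 1) : γ.real {x | cdf γ x ≤ u} = u := by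
  rcases hu.1.eq_or_lt with rfl | h0
  · convert measureReal_empty
    exact eq_empty_of_forall_notMem fun x hx => absurd (cdf_mem_Ioo hγ' x).1 (not_lt.2 hx)
  rcases hu.2.eq_or_lt with rfl | h1
  · convert probReal_univ
    · exact eq_univ_of_forall fun x => (cdf_mem_Ioo hγ' x).2.le
    · infer_instance
  have hc := continuous_cdf γ hγ
  set S := {x | cdf γ x ≤ u} with hS
  obtain ⟨s, hs⟩ : ∃ s, IsGreatest S s := by
    have hne : S.Nonempty := by
      obtain ⟨t, ht⟩ := ((tendsto_cdf_atBot γ).eventually (gt_mem_nhds h0)).exists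
      exact ⟨t, le_of_lt ht⟩
    have hb : BddAbove S := by
      obtain ⟨t, ht⟩ := ((tendsto_cdf_atTop γ).eventually (lt_mem_nhds h1)).exists
      exact ⟨t, fun s hs => le_of_not_gt fun hst =>
        absurd ((monotone_cdf γ hst.le).trans hs) (not_le.2 ht)⟩
    exact ⟨_, (isClosed_le hc continuous_const).csSup_mem hne hb, fun x hx => le_csSup hb hx⟩
  have hSI : S = Iic s := by
    ext x
    exact ⟨fun hx => hs.2 hx, fun hx => (monotone_cdf γ hx).trans hs.1⟩
  have hsu : cdf γ s = u := by
    refine le_antisymm hs.1 (ge_of_tendsto (x := 𝓝[>] s) (f := cdf γ)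
      hc.continuousWithinAt ?_)
    filter_upwards [self_mem_nhdsWithin] with x hx
    exact le_of_not_ge fun h => absurd (hs.2 h) (not_le.2 hx)
  rw [hSI, ← cdf_eq_real, hsu]

/-- The increasing rearrangement pushing `γ` onto `μ`, together with the one-dimensional
Monge–Ampère equation it satisfies. -/
theorem exists_monotone_transport (γ μ : Measure ℝ) [IsProbabilityMeasure γ]
    [IsProbabilityMeasure μ] (hγ : γ ≪ volume) (hγ' : volume ≪ γ) (hμ : μ ≪ volume) :
    ∃ T : ℝ → ℝ, Monotone T ∧ MeasurePreserving T γ μ ∧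
      ∀ᵐ x, HasDerivAt T
        ((γ.rnDeriv volume x).toReal / (μ.rnDeriv volume (T x)).toReal) x := by
  have hF := continuous_cdf μ hμ
  set T : ℝ → ℝ := fun x => quantile μ (cdf γ x) with hT
  have hFT : ∀ x, cdf μ (T x) = cdf γ x := fun x => cdf_quantile hF (cdf_mem_Ioo hγ' x)
  have hle : ∀ x t, T x ≤ t ↔ cdf γ x ≤ cdf μ t := fun x t =>
    quantile_le_iff hF (cdf_mem_Ioo hγ' x) t
  have hmono : Monotone T := fun x y hxy => (hle _ _).2 (by rw [hFT]; exact monotone_cdf γ hxy)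
  have hmap : γ.map T = μ := by
    have := Measure.isProbabilityMeasure_map (μ := γ) hmono.measurable.aemeasurable
    refine Measure.eq_of_cdf _ _ ?_
    ext t
    rw [cdf_eq_real, map_measureReal_apply hmono.measurable measurableSet_Iic]
    have : T ⁻¹' Iic t = {x | cdf γ x ≤ cdf μ t} := by
      ext x
      exact hle x t
    rw [this, measureReal_cdf_le hγ hγ' ⟨cdf_nonneg _ _, cdf_le_one _ _⟩]
  have hmp : MeasurePreserving T γ μ := ⟨hmono.measurable, hmap⟩
  refine ⟨T, hmono, hmp, ?_⟩
  have hdμ : ∀ᵐ t, HasDerivAt (cdf μ) (μ.rnDeriv volume t).toReal t := by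
    simpa only [measure_cdf] using (cdf μ).ae_hasDerivAt
  have hdγ : ∀ᵐ t, HasDerivAt (cdf γ) (γ.rnDeriv volume t).toReal t := by
    simpa only [measure_cdf] using (cdf γ).ae_hasDerivAt
  have hpos : ∀ᵐ x, 0 < (γ.rnDeriv volume x).toReal := by
    filter_upwards [hγ' (Measure.rnDeriv_pos hγ), Measure.rnDeriv_lt_top γ volume] with x h1 h2
    exact ENNReal.toReal_pos h1.ne' h2.ne
  filter_upwards [hmono.ae_differentiableAt, hdγ, hpos,
    hγ' (hmp.quasiMeasurePreserving.ae (hμ hdμ))] with x h1 h2 h3 h4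
  have h5 := h4.comp x h1.hasDerivAt
  have h6 : cdf μ ∘ T = cdf γ := funext hFT
  rw [h6] at h5
  have h7 := h5.unique h2
  have h8 : (μ.rnDeriv volume (T x)).toReal ≠ 0 := by
    intro h
    rw [h, zero_mul] at h7
    exact h3.ne h7
  rw [← h7, mul_div_cancel_left₀ _ h8]
  exact h1.hasDerivAt

/-- One-sided change of variables for a monotone function, whose derivative may miss part of
its variation. -/
theorem lintegral_deriv_mul_comp_le {Θ D : ℝ → ℝ} (hΘ : Monotone Θ)
    (hD : ∀ᵐ x, HasDerivAt Θ (D x) x) (h : ℝ → ENNReal) :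
    ∫⁻ x, ENNReal.ofReal (D x) * h (Θ x) ≤ ∫⁻ x, h x := by
  set s := (toMeasurable volume {x | ¬ HasDerivAt Θ (D x) x})ᶜ with hs
  have hsm : MeasurableSet s := (measurableSet_toMeasurable _ _).compl
  have hs0 : volume sᶜ = 0 := by
    rw [hs, compl_compl, measure_toMeasurable]
    exact hD
  have hsD : ∀ x ∈ s, HasDerivAt Θ (D x) x := fun x hx => by
    by_contra hn
    exact hx (subset_toMeasurable _ _ hn)
  calc ∫⁻ x, ENNReal.ofReal (D x) * h (Θ x) = ∫⁻ x in s, ENNReal.ofReal (D x) * h (Θ x) := by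
        rw [Measure.restrict_eq_self_of_ae_mem (show ∀ᵐ x, x ∈ s from hs0)]
    _ = ∫⁻ x in Θ '' s, h x :=
        (lintegral_image_eq_lintegral_deriv_mul_of_monotoneOn hsm
          (fun x hx => (hsD x hx).hasDerivWithinAt) (hΘ.monotoneOn s) h).symm
    _ ≤ ∫⁻ x, h x := setLIntegral_le_lintegral _ _

/-- A reflection of the plane preserves Lebesgue measure. -/
theorem measurePreserving_reflection {a b : ℝ} (hab : a ^ 2 + b ^ 2 = 1) :
    MeasurePreserving (fun p : ℝ × ℝ => (a * p.2 - b * p.1, b * p.2 + a * p.1)) := by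
  set L := Matrix.toLin (Module.Basis.finTwoProd ℝ) (Module.Basis.finTwoProd ℝ) !![-b, a; a, b]
    with hL
  have hdet : LinearMap.det L = -1 := by
    rw [hL, LinearMap.det_toLin, Matrix.det_fin_two_of]
    linarith
  have hLf : ⇑L = fun p : ℝ × ℝ => (a * p.2 - b * p.1, b * p.2 + a * p.1) := by
    ext p <;> simp [hL, Matrix.toLin_finTwoProd_apply] <;> ring
  rw [← hLf]
  refine ⟨L.continuous_of_finiteDimensional.measurable, ?_⟩
  rw [Measure.map_linearMap_addHaar_eq_smul_addHaar _ (by simp [hdet])]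
  simp [hdet]

theorem log_gaussianPDFReal (x : ℝ) :
    Real.log (gaussianPDFReal 0 1 x) = Real.log (√(2 * Real.pi))⁻¹ - x ^ 2 / 2 := by
  rw [gaussianPDFReal, Real.log_mul (by positivity) (Real.exp_pos _).ne', Real.log_exp]
  norm_num
  ring

theorem gaussianPDFReal_mul_rotation {a b : ℝ} (hab : a ^ 2 + b ^ 2 = 1) (s t : ℝ) :
    gaussianPDFReal 0 1 (a * s - b * t) * gaussianPDFReal 0 1 (b * s + a * t) =
      gaussianPDFReal 0 1 s * gaussianPDFReal 0 1 t := by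
  have key : -(a * s - b * t) ^ 2 / 2 + -(b * s + a * t) ^ 2 / 2 = -s ^ 2 / 2 + -t ^ 2 / 2 := by
    linear_combination -(s ^ 2 + t ^ 2) / 2 * hab
  simp only [gaussianPDFReal, sub_zero, NNReal.coe_one, mul_one]
  rw [mul_mul_mul_comm, ← Real.exp_add, key, Real.exp_add, mul_mul_mul_comm]

theorem gaussianReal_prod_eq_withDensity :
    (gaussianReal 0 1).prod (gaussianReal 0 1) =
      (volume : Measure (ℝ × ℝ)).withDensity
        (fun p => ENNReal.ofReal (gaussianPDFReal 0 1 p.1 * gaussianPDFReal 0 1 p.2)) := by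
  rw [gaussianReal_of_var_ne_zero 0 one_ne_zero,
    prod_withDensity (measurable_gaussianPDF 0 1) (measurable_gaussianPDF 0 1)]
  congr 1
  ext p
  rw [ENNReal.ofReal_mul (gaussianPDFReal_nonneg 0 1 _)]
  rfl

/-- For independent standard Gaussians, conditionally on the rotated coordinate `-b x + a y`, the
map `T x + U y` is a monotone function of `a x + b y`; this integrates the resulting
density ratio. -/
theorem lintegral_density_ratio_le_one {a b : ℝ} (ha : 0 < a) (hb : 0 < b)
    (hab : a ^ 2 + b ^ 2 = 1) {T U T' U' : ℝ → ℝ} (hT : Monotone T) (hU : Monotone U)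
    (hT'm : Measurable T') (hU'm : Measurable U')
    (hT' : ∀ᵐ x, HasDerivAt T (T' x) x) (hU' : ∀ᵐ x, HasDerivAt U (U' x) x)
    {h : ℝ → ENNReal} (hm : Measurable h) (hh : ∫⁻ z, h z ≤ 1) :
    ∫⁻ p, ENNReal.ofReal ((a * T' p.1 + b * U' p.2) / gaussianPDFReal 0 1 (a * p.1 + b * p.2)) *
      h (T p.1 + U p.2) ∂(gaussianReal 0 1).prod (gaussianReal 0 1) ≤ 1 := by
  have hφ := measurable_gaussianPDFReal 0 1
  have hTm := hT.measurable
  have hUm := hU.measurable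
  have hR := measurePreserving_reflection hab
  rw [gaussianReal_prod_eq_withDensity, lintegral_withDensity_eq_lintegral_mul _ (by fun_prop)
    (by fun_prop), ← hR.lintegral_comp (by fun_prop), Measure.volume_eq_prod,
    lintegral_prod _ (by fun_prop)]
  have hd : ∀ᵐ p : ℝ × ℝ, HasDerivAt T (T' p.1) p.1 ∧ HasDerivAt U (U' p.2) p.2 :=
    (Measure.quasiMeasurePreserving_fst.ae hT').and (Measure.quasiMeasurePreserving_snd.ae hU')
  have hd2 := Measure.ae_ae_of_ae_prod (hR.quasiMeasurePreserving.ae hd)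
  calc _ ≤ ∫⁻ t, ENNReal.ofReal (gaussianPDFReal 0 1 t) := by
        refine lintegral_mono_ae ?_
        filter_upwards [hd2] with t ht
        set Θ : ℝ → ℝ := fun s => T (a * s - b * t) + U (b * s + a * t) with hΘ
        set D : ℝ → ℝ := fun s => a * T' (a * s - b * t) + b * U' (b * s + a * t) with hD
        have hΘm : Monotone Θ := fun s s' hs => by
          simp only [hΘ]
          gcongr
          · exact hT (by gcongr)
          · exact hU (by gcongr)
        have hΘD : ∀ᵐ s, HasDerivAt Θ (D s) s := by
          filter_upwards [ht] with s hs
          have h1 : HasDerivAt (fun s => a * s - b * t) a s := by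
            simpa using ((hasDerivAt_id s).const_mul a).sub_const (b * t)
          have h2 : HasDerivAt (fun s => b * s + a * t) b s := by
            simpa using ((hasDerivAt_id s).const_mul b).add_const (a * t)
          have h3 := (hs.1.comp s h1).add (hs.2.comp s h2)
          simp only [hD]
          rw [mul_comm a, mul_comm b (U' _)]
          exact h3
        calc _ = ∫⁻ s, ENNReal.ofReal (gaussianPDFReal 0 1 t) *
              (ENNReal.ofReal (D s) * h (Θ s)) := by
              refine lintegral_congr fun s => ?_
              have e1 : a * (a * s - b * t) + b * (b * s + a * t) = s := by
                linear_combination s * hab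
              simp only [Pi.mul_apply, e1]
              rw [gaussianPDFReal_mul_rotation hab, ← mul_assoc, ← mul_assoc,
                ← ENNReal.ofReal_mul (mul_nonneg (gaussianPDFReal_nonneg 0 1 s)
                  (gaussianPDFReal_nonneg 0 1 t)),
                ← ENNReal.ofReal_mul (gaussianPDFReal_nonneg 0 1 t)]
              congr 2
              have := (gaussianPDFReal_pos 0 1 s one_ne_zero).ne'
              change _ * _ * (D s / _) = _
              field_simp
          _ = ENNReal.ofReal (gaussianPDFReal 0 1 t) * ∫⁻ s, ENNReal.ofReal (D s) * h (Θ s) := by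
              rw [lintegral_const_mul]
              simp only [hΘ, hD]
              fun_prop
          _ ≤ ENNReal.ofReal (gaussianPDFReal 0 1 t) * 1 := by
              gcongr
              exact (lintegral_deriv_mul_comp_le hΘm hΘD h).trans hh
          _ = _ := mul_one _
    _ = 1 := lintegral_gaussianPDFReal_eq_one 0 one_ne_zero

/-- The weighted logarithmic inequality obtained from concavity of `log` and
`log r ≤ r - 1`. -/
theorem log_density_le {a b : ℝ} (ha : 0 < a) (hb : 0 < b) (hab : a ^ 2 + b ^ 2 = 1)
    {x y f g k : ℝ} (hf : 0 < f) (hg : 0 < g) (hk : 0 < k) :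
    Real.log k - a ^ 2 * (Real.log f + Real.log a) - b ^ 2 * (Real.log g + Real.log b) +
        a * b * (x * y) ≤
      (a * (gaussianPDFReal 0 1 x / f) + b * (gaussianPDFReal 0 1 y / g)) /
        gaussianPDFReal 0 1 (a * x + b * y) * k - 1 := by
  have hφ : ∀ x, 0 < gaussianPDFReal 0 1 x := fun x => gaussianPDFReal_pos 0 1 x one_ne_zero
  have hx := hφ x
  have hy := hφ y
  have hz := hφ (a * x + b * y)
  have hconc := strictConcaveOn_log_Ioi.concaveOn.2
    (x := gaussianPDFReal 0 1 x / f / a) (y := gaussianPDFReal 0 1 y / g / b)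
    (mem_Ioi.2 (by positivity)) (mem_Ioi.2 (by positivity)) (sq_nonneg a) (sq_nonneg b) hab
  have e : a ^ 2 • (gaussianPDFReal 0 1 x / f / a) + b ^ 2 • (gaussianPDFReal 0 1 y / g / b) =
      a * (gaussianPDFReal 0 1 x / f) + b * (gaussianPDFReal 0 1 y / g) := by
    simp only [smul_eq_mul]
    field_simp
  rw [e, Real.log_div (by positivity) ha.ne', Real.log_div (by positivity) hb.ne',
    Real.log_div (by positivity) hf.ne', Real.log_div (by positivity) hg.ne',
    log_gaussianPDFReal, log_gaussianPDFReal, smul_eq_mul, smul_eq_mul] at hconc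
  refine le_trans ?_ (Real.log_le_sub_one_of_pos (by positivity))
  rw [Real.log_mul (by positivity) hk.ne', Real.log_div (by positivity) hz.ne',
    log_gaussianPDFReal]
  linear_combination hconc - Real.log (√(2 * Real.pi))⁻¹ * hab

/-- The entropy power inequality in Lieb's linearised form, with the densities expressed as
Radon–Nikodym derivatives. -/
theorem integral_log_rnDeriv_le {μ ν ρ : Measure ℝ} [IsProbabilityMeasure μ]
    [IsProbabilityMeasure ν] [IsProbabilityMeasure ρ] (hμ : μ ≪ volume) (hν : ν ≪ volume)
    (hρ : ρ ≪ volume) (hconv : MeasurePreserving (fun p : ℝ × ℝ => p.1 + p.2) (μ.prod ν) ρ)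
    (hiμ : Integrable (fun x => Real.log (μ.rnDeriv volume x).toReal) μ)
    (hiν : Integrable (fun x => Real.log (ν.rnDeriv volume x).toReal) ν)
    (hiρ : Integrable (fun x => Real.log (ρ.rnDeriv volume x).toReal) ρ)
    {a b : ℝ} (ha : 0 < a) (hb : 0 < b) (hab : a ^ 2 + b ^ 2 = 1) :
    ∫ x, Real.log (ρ.rnDeriv volume x).toReal ∂ρ ≤
      a ^ 2 * (∫ x, Real.log (μ.rnDeriv volume x).toReal ∂μ + Real.log a) +
        b ^ 2 * (∫ x, Real.log (ν.rnDeriv volume x).toReal ∂ν + Real.log b) := by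
  set γ := gaussianReal 0 1 with hγdef
  have hγ : γ ≪ volume := gaussianReal_absolutelyContinuous 0 one_ne_zero
  have hγ' : volume ≪ γ := gaussianReal_absolutelyContinuous' 0 one_ne_zero
  obtain ⟨T, hT, hTμ, hTd⟩ := exists_monotone_transport γ μ hγ hγ' hμ
  obtain ⟨U, hU, hUν, hUd⟩ := exists_monotone_transport γ ν hγ hγ' hν
  have hφ : ∀ᵐ x, (γ.rnDeriv volume x).toReal = gaussianPDFReal 0 1 x := by
    filter_upwards [rnDeriv_gaussianReal 0 1] with x hx
    rw [hx, toReal_gaussianPDF]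
  set f := fun x => (μ.rnDeriv volume x).toReal with hf
  set g := fun x => (ν.rnDeriv volume x).toReal with hg
  set k := fun x => (ρ.rnDeriv volume x).toReal with hk
  have hpos : ∀ {κ : Measure ℝ} [IsProbabilityMeasure κ], κ ≪ volume →
      ∀ᵐ x ∂κ, 0 < (κ.rnDeriv volume x).toReal := fun {κ} _ hκ => by
    filter_upwards [Measure.rnDeriv_pos hκ, hκ (Measure.rnDeriv_lt_top κ volume)] with x h1 h2
    exact ENNReal.toReal_pos h1.ne' h2.ne
  have hfm : Measurable f := (Measure.measurable_rnDeriv _ _).ennreal_toReal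
  have hgm : Measurable g := (Measure.measurable_rnDeriv _ _).ennreal_toReal
  have hkm : Measurable k := (Measure.measurable_rnDeriv _ _).ennreal_toReal
  have hφm := measurable_gaussianPDFReal 0 1
  have hTm := hT.measurable
  have hUm := hU.measurable
  have hfst : MeasurePreserving (fun p : ℝ × ℝ => T p.1) (γ.prod γ) μ :=
    hTμ.comp measurePreserving_fst
  have hsnd : MeasurePreserving (fun p : ℝ × ℝ => U p.2) (γ.prod γ) ν :=
    hUν.comp measurePreserving_snd
  have hsum : MeasurePreserving (fun p : ℝ × ℝ => T p.1 + U p.2) (γ.prod γ) ρ :=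
    hconv.comp (hTμ.prod hUν)
  set r : ℝ × ℝ → ℝ := fun p =>
    (a * (gaussianPDFReal 0 1 p.1 / f (T p.1)) + b * (gaussianPDFReal 0 1 p.2 / g (U p.2))) /
      gaussianPDFReal 0 1 (a * p.1 + b * p.2) * k (T p.1 + U p.2) with hr
  have hrm : Measurable r := by fun_prop
  have hr0 : ∀ p, 0 ≤ r p := fun p => by
    have := gaussianPDFReal_nonneg 0 1
    have h1 := this p.1
    have h2 := this p.2
    have h3 := this (a * p.1 + b * p.2)
    have h4 : 0 ≤ f (T p.1) := ENNReal.toReal_nonneg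
    have h5 : 0 ≤ g (U p.2) := ENNReal.toReal_nonneg
    have h6 : 0 ≤ k (T p.1 + U p.2) := ENNReal.toReal_nonneg
    positivity
  have hr1 : ∫⁻ p, ENNReal.ofReal (r p) ∂γ.prod γ ≤ 1 := by
    have key := lintegral_density_ratio_le_one ha hb hab hT hU
      (T' := fun x => gaussianPDFReal 0 1 x / f (T x))
      (U' := fun x => gaussianPDFReal 0 1 x / g (U x)) (by fun_prop) (by fun_prop)
      (by filter_upwards [hTd, hφ] with x h1 h2; rwa [h2] at h1)
      (by filter_upwards [hUd, hφ] with x h1 h2; rwa [h2] at h1)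
      (h := fun z => ENNReal.ofReal (k z)) (by fun_prop)
      (by
        calc ∫⁻ z, ENNReal.ofReal (k z) ≤ ∫⁻ z, ρ.rnDeriv volume z :=
              lintegral_mono fun z => ENNReal.ofReal_toReal_le
          _ ≤ ρ univ := Measure.lintegral_rnDeriv_le
          _ = 1 := measure_univ)
    refine le_trans (le_of_eq (lintegral_congr fun p => ?_)) key
    rw [← ENNReal.ofReal_mul' ENNReal.toReal_nonneg]
  have hri : Integrable r (γ.prod γ) := by
    refine ⟨hrm.aestronglyMeasurable, ?_⟩
    rw [hasFiniteIntegral_iff_ofReal (ae_of_all _ hr0)]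
    exact hr1.trans_lt ENNReal.one_lt_top
  have hrle : ∫ p, r p ∂γ.prod γ ≤ 1 := by
    rw [integral_eq_lintegral_of_nonneg_ae (ae_of_all _ hr0) hrm.aestronglyMeasurable]
    exact ENNReal.toReal_le_of_le_ofReal zero_le_one (by simpa using hr1)
  have hid : Integrable (fun x : ℝ => x) γ :=
    (memLp_id_gaussianReal' 1 (by simp)).integrable le_rfl
  have hixy : Integrable (fun p : ℝ × ℝ => p.1 * p.2) (γ.prod γ) := hid.mul_prod hid
  have hxy0 : ∫ p : ℝ × ℝ, p.1 * p.2 ∂γ.prod γ = 0 := by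
    rw [integral_prod_mul (fun x : ℝ => x) (fun y : ℝ => y), hγdef, integral_id_gaussianReal,
      zero_mul]
  have hif : Integrable (fun p : ℝ × ℝ => Real.log (f (T p.1))) (γ.prod γ) :=
    hfst.integrable_comp_of_integrable hiμ
  have hig : Integrable (fun p : ℝ × ℝ => Real.log (g (U p.2))) (γ.prod γ) :=
    hsnd.integrable_comp_of_integrable hiν
  have hik : Integrable (fun p : ℝ × ℝ => Real.log (k (T p.1 + U p.2))) (γ.prod γ) :=
    hsum.integrable_comp_of_integrable hiρ
  have hIf : ∫ p : ℝ × ℝ, Real.log (f (T p.1)) ∂γ.prod γ = ∫ x, Real.log (f x) ∂μ := by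
    rw [← hfst.map_eq, integral_map hfst.aemeasurable hfm.log.aestronglyMeasurable]
  have hIg : ∫ p : ℝ × ℝ, Real.log (g (U p.2)) ∂γ.prod γ = ∫ x, Real.log (g x) ∂ν := by
    rw [← hsnd.map_eq, integral_map hsnd.aemeasurable hgm.log.aestronglyMeasurable]
  have hIk : ∫ p : ℝ × ℝ, Real.log (k (T p.1 + U p.2)) ∂γ.prod γ = ∫ x, Real.log (k x) ∂ρ := by
    rw [← hsum.map_eq, integral_map hsum.aemeasurable hkm.log.aestronglyMeasurable]
  have hmain : ∀ᵐ p ∂γ.prod γ, Real.log (k (T p.1 + U p.2)) -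
      a ^ 2 * (Real.log (f (T p.1)) + Real.log a) - b ^ 2 * (Real.log (g (U p.2)) + Real.log b) +
        a * b * (p.1 * p.2) ≤ r p - 1 := by
    filter_upwards [hfst.quasiMeasurePreserving.ae (hpos hμ),
      hsnd.quasiMeasurePreserving.ae (hpos hν), hsum.quasiMeasurePreserving.ae (hpos hρ)]
      with p h1 h2 h3
    exact log_density_le ha hb hab h1 h2 h3
  have i1 := (hif.add (integrable_const (Real.log a))).const_mul (a ^ 2)
  have i2 := (hig.add (integrable_const (Real.log b))).const_mul (b ^ 2)
  have i3 := hixy.const_mul (a * b)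
  have hle := integral_mono_ae (((hik.sub i1).sub i2).add i3) (hri.sub (integrable_const 1)) hmain
  have e1 := integral_add ((hik.sub i1).sub i2) i3
  have e2 := integral_sub (hik.sub i1) i2
  have e3 := integral_sub hik i1
  have e4 := integral_add hif (integrable_const (Real.log a))
  have e5 := integral_add hig (integrable_const (Real.log b))
  have e6 := integral_sub hri (integrable_const 1)
  simp only [Pi.add_apply, Pi.sub_apply, integral_const_mul, integral_const, probReal_univ,
    smul_eq_mul, one_mul] at hle e1 e2 e3 e4 e5 e6
  rw [e1, e2, e3, e4, e5, e6, hIf, hIg, hIk, hxy0] at hle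
  linarith

end

/-- **Shannon's entropy power inequality.**  If `X` and `Y` are independent real random
variables, each with a probability density w.r.t. Lebesgue measure and finite differential
entropy, and `X + Y` also has finite differential entropy, then
`e^{2H(X+Y)} ≥ e^{2H(X)} + e^{2H(Y)}`. -/
theorem entropy_power_inequality
    {Ω : Type*} [MeasureSpace Ω] [IsProbabilityMeasure (ℙ : Measure Ω)]
    (X Y : Ω → ℝ) (hmX : Measurable X) (hmY : Measurable Y)
    (hind : IndepFun X Y ℙ)
    [MeasureTheory.HasPDF X ℙ volume] [MeasureTheory.HasPDF Y ℙ volume]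
    [MeasureTheory.HasPDF (X + Y) ℙ volume]
    (hX : Integrable (fun x => (MeasureTheory.pdf X ℙ volume x).toReal *
        Real.log ((MeasureTheory.pdf X ℙ volume x).toReal)) volume)
    (hY : Integrable (fun x => (MeasureTheory.pdf Y ℙ volume x).toReal *
        Real.log ((MeasureTheory.pdf Y ℙ volume x).toReal)) volume)
    (hXY : Integrable (fun x => (MeasureTheory.pdf (X + Y) ℙ volume x).toReal *
        Real.log ((MeasureTheory.pdf (X + Y) ℙ volume x).toReal)) volume) :
    Real.exp (2 * diffEntropy (X + Y)) ≥
      Real.exp (2 * diffEntropy X) + Real.exp (2 * diffEntropy Y) := by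
  have hacX : (ℙ : Measure Ω).map X ≪ volume := HasPDF.absolutelyContinuous
  have hacY : (ℙ : Measure Ω).map Y ≪ volume := HasPDF.absolutelyContinuous
  have hacXY : (ℙ : Measure Ω).map (X + Y) ≪ volume := HasPDF.absolutelyContinuous
  have := Measure.isProbabilityMeasure_map (μ := (ℙ : Measure Ω)) hmX.aemeasurable
  have := Measure.isProbabilityMeasure_map (μ := (ℙ : Measure Ω)) hmY.aemeasurable
  have := Measure.isProbabilityMeasure_map (μ := (ℙ : Measure Ω)) (hmX.add hmY).aemeasurable
  have hconv : MeasurePreserving (fun p : ℝ × ℝ => p.1 + p.2)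
      (((ℙ : Measure Ω).map X).prod ((ℙ : Measure Ω).map Y)) ((ℙ : Measure Ω).map (X + Y)) := by
    have hadd : Measurable (fun p : ℝ × ℝ => p.1 + p.2) := by fun_prop
    refine ⟨hadd, ?_⟩
    rw [← (indepFun_iff_map_prod_eq_prod_map_map hmX.aemeasurable hmY.aemeasurable).1 hind,
      Measure.map_map hadd (hmX.prodMk hmY)]
    rfl
  have hent : ∀ Z : Ω → ℝ, (ℙ : Measure Ω).map Z ≪ volume → diffEntropy Z =
      -∫ x, Real.log (((ℙ : Measure Ω).map Z).rnDeriv volume x).toReal ∂(ℙ : Measure Ω).map Z :=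
    fun Z hZ => by
      rw [← integral_rnDeriv_smul hZ]
      rfl
  set P := Real.exp (2 * diffEntropy X) with hP
  set Q := Real.exp (2 * diffEntropy Y) with hQ
  have hP0 : 0 < P := Real.exp_pos _
  have hQ0 : 0 < Q := Real.exp_pos _
  have ha2 : √(P / (P + Q)) ^ 2 = P / (P + Q) := Real.sq_sqrt (by positivity)
  have hb2 : √(Q / (P + Q)) ^ 2 = Q / (P + Q) := Real.sq_sqrt (by positivity)
  have hab : P / (P + Q) + Q / (P + Q) = 1 := by
    rw [← add_div, div_self (by positivity)]
  have key := integral_log_rnDeriv_le hacX hacY hacXY hconv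
    ((integrable_rnDeriv_smul_iff hacX).1 hX) ((integrable_rnDeriv_smul_iff hacY).1 hY)
    ((integrable_rnDeriv_smul_iff hacXY).1 hXY)
    (a := √(P / (P + Q))) (b := √(Q / (P + Q))) (by positivity) (by positivity)
    (by rw [ha2, hb2, hab])
  rw [ha2, hb2, Real.log_sqrt (by positivity), Real.log_sqrt (by positivity),
    Real.log_div hP0.ne' (by positivity), Real.log_div hQ0.ne' (by positivity), hP, hQ,
    Real.log_exp, Real.log_exp, ← hP, ← hQ] at key
  have hXe := hent X hacX
  have hYe := hent Y hacY
  have hXYe := hent (X + Y) hacXY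
  have hlog : Real.log (P + Q) ≤ 2 * diffEntropy (X + Y) := by
    linear_combination 2 * key - Real.log (P + Q) * hab - 2 * hXYe
      + 2 * P / (P + Q) * hXe + 2 * Q / (P + Q) * hYe
  rw [ge_iff_le, ← Real.log_le_iff_le_exp (by positivity)]
  exact hlog
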